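/- arXiv:2112.14818 — 6 statements merged into one kernel-verified Lean document; each statement's English description precedes it below -/
import Mathlib

section
/- Let d ≥ 5 be an integer with d ≠ 6, and let q be the smallest prime number that does not divide 2d. Then either 2q < d or 2q = d + 1; moreover, if 2q = d + 1 then d = 5 or d = 9. -/
/-- Let `d ≥ 5` be an integer with `d ≠ 6`, and let `q` be the smallest prime not dividing
`2d`. Then `2q < d` or `2q = d + 1`, and the latter happens only for `d = 5` or `d = 9`. -/
theorem stmt_0 (d q : ℕ) (hd : 5 ≤ d) (hd6 : d ≠ 6)
    (hq : Nat.Prime q) (hqd : ¬ q ∣ 2 * d)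
    (hmin : ∀ p : ℕ, Nat.Prime p → ¬ p ∣ 2 * d → q ≤ p) :
    (2 * q < d ∨ 2 * q = d + 1) ∧ (2 * q = d + 1 → d = 5 ∨ d = 9) := by
  have dvd_of_lt : ∀ p : ℕ, p.Prime → p ≠ 2 → p < q → p ∣ d := by
    intro p hp hp2 hpq
    have h : p ∣ 2 * d := by
      by_contra h
      exact absurd (hmin p hp h) (by omega)
    exact (hp.dvd_mul.mp h).resolve_left
      fun h2 => hp2 ((Nat.prime_dvd_prime_iff_eq hp Nat.prime_two).mp h2)
  have hq2 : q ≠ 2 := by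
    rintro rfl
    exact hqd (dvd_mul_right 2 d)
  have hq_two_le := hq.two_le
  have hq4 : q ≠ 4 := by rintro rfl; revert hq; decide
  have hq6 : q ≠ 6 := by rintro rfl; revert hq; decide
  obtain rfl | hq3 := eq_or_ne q 3
  · omega
  have h3 : 3 ∣ d := dvd_of_lt 3 Nat.prime_three (by omega) (by omega)
  obtain rfl | hq5 := eq_or_ne q 5
  · omega
  have h5 : 5 ∣ d := dvd_of_lt 5 Nat.prime_five (by omega) (by omega)
  suffices 2 * q < d by omega
  obtain hq7 | hq7 := le_or_gt q 7
  · omega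
  have hodd : q % 2 = 1 := hq.eq_two_or_odd.resolve_left hq2
  have hq9 : q ≠ 9 := by rintro rfl; revert hq; decide
  obtain ⟨p, hp, hlt, hle⟩ := Nat.exists_prime_lt_and_le_two_mul ((q - 1) / 2) (by omega)
  have hpd : p ∣ d := dvd_of_lt p hp (by omega) (by omega)
  have hcop : Nat.Coprime 15 p := by
    refine Nat.Coprime.mul_left (m := 3) (n := 5) ?_ ?_
    · exact (Nat.coprime_primes Nat.prime_three hp).mpr (by omega)
    · exact (Nat.coprime_primes Nat.prime_five hp).mpr (by omega)
  have hle_d := Nat.le_of_dvd (by omega) (hcop.mul_dvd_of_dvd_of_dvd (by omega) hpd)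
  omega
end

section
/- Let d ≥ 1 be an integer whose Euler totient satisfies φ(d) > 2, and let N ≥ 4 be an even integer. Then there exists a = (a_1,…,a_N) ∈ (ℤ/dℤ)^N with a_1 + ⋯ + a_N = 0 in ℤ/dℤ, a_i ≠ 0 for every i, val(a_1) + ⋯ + val(a_N) = dN/2, and there exists a unit t of ℤ/dℤ with val(t·a_1) + ⋯ + val(t·a_N) ≠ dN/2. -/
theorem ZMod.val_add_val_neg {d : ℕ} [NeZero d] {x : ZMod d} (hx : x ≠ 0) :
    x.val + (-x).val = d := by
  have : NeZero x := ⟨hx⟩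
  rw [ZMod.val_neg_of_ne_zero]
  have := x.val_lt
  omega

theorem ZMod.exists_unit_ne_one_ne_neg_one {d : ℕ} [NeZero d] (hphi : 2 < Nat.totient d) :
    ∃ t : (ZMod d)ˣ, t ≠ 1 ∧ t ≠ -1 := by
  by_contra! h
  have hsub : (Finset.univ : Finset (ZMod d)ˣ) ⊆ {1, -1} := by
    intro t _
    by_cases ht : t = 1
    · simp [ht]
    · simp [h t ht]
  have hcard := (Finset.card_le_card hsub).trans Finset.card_le_two
  rw [Finset.card_univ, ZMod.card_units_eq_totient] at hcard
  omega

theorem eq_add_mul_of_second_difference_eq_zero {f : ℕ → ℤ} {n : ℕ}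
    (h : ∀ x, x + 2 ≤ n → f x + f (x + 2) = 2 * f (x + 1)) :
    ∀ x, x + 1 ≤ n →
      f x = f 0 + x * (f 1 - f 0) ∧ f (x + 1) = f 0 + (x + 1) * (f 1 - f 0) := by
  intro x
  induction x with
  | zero => intro _; simp
  | succ x ih =>
    intro hx
    obtain ⟨h₀, h₁⟩ := ih (by omega)
    have h₂ := h x hx
    push_cast
    exact ⟨h₁, by linear_combination h₂ - h₀ + 2 * h₁⟩

/-- Multiplication by a unit other than `±1` is not affine on the representatives
`1, …, d - 1`. -/
theorem ZMod.exists_val_mul_second_difference_ne_zero {d : ℕ} [NeZero d] (hd : 3 ≤ d)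
    {t : (ZMod d)ˣ} (h1 : t ≠ 1) (h2 : t ≠ -1) :
    ∃ x : ℕ, 1 ≤ x ∧ x + 2 < d ∧
      ((t : ZMod d) * (x : ℕ)).val + ((t : ZMod d) * (x + 2 : ℕ)).val
        ≠ 2 * ((t : ZMod d) * (x + 1 : ℕ)).val := by
  by_contra! h
  have : Fact (1 < d) := ⟨by omega⟩
  obtain ⟨n, rfl⟩ : ∃ n, d = n + 3 := ⟨d - 3, by omega⟩
  have haff := (eq_add_mul_of_second_difference_eq_zero
    (f := fun x ↦ (((t : ZMod (n + 3)) * (x + 1 : ℕ)).val : ℤ)) (n := n + 1)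
    (fun x hx ↦ by exact_mod_cast h (x + 1) (by omega) (by omega)) n le_rfl).2
  have hlast : ((n + 1 + 1 : ℕ) : ZMod (n + 3)) = -1 := by
    rw [eq_neg_iff_add_eq_zero]
    exact_mod_cast ZMod.natCast_self (n + 3)
  have ht0 : (t : ZMod (n + 3)) ≠ 0 := t.ne_zero
  have hneg := ZMod.val_add_val_neg ht0
  have htwo : (t : ZMod (n + 3)) * (1 + 1 : ℕ) = t + t := by push_cast; ring
  simp only [hlast, htwo, zero_add, Nat.cast_one, mul_one, mul_neg] at haff
  have hlt := (t : ZMod (n + 3)).val_lt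
  have hneg' : (((-t : ZMod (n + 3))).val : ℤ) = n + 3 - (t : ZMod (n + 3)).val := by omega
  rw [hneg'] at haff
  rcases lt_or_ge ((t : ZMod (n + 3)).val + (t : ZMod (n + 3)).val) (n + 3) with hc | hc
  · rw [ZMod.val_add_of_lt hc] at haff
    push_cast at haff
    have hv : ((t : ZMod (n + 3)).val : ℤ) = 1 := by
      have : ((n : ℤ) + 3) * ((t : ZMod (n + 3)).val - 1) = 0 := by linear_combination -haff
      rcases mul_eq_zero.mp this with h | h <;> omega
    apply h1
    ext
    apply ZMod.val_injective
    rw [Units.val_one, ZMod.val_one]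
    exact_mod_cast hv
  · have hadd := ZMod.val_add_val_of_le hc
    have hadd' : (((t + t : ZMod (n + 3))).val : ℤ) =
        2 * (t : ZMod (n + 3)).val - (n + 3) := by omega
    rw [hadd'] at haff
    have hv : ((t : ZMod (n + 3)).val : ℤ) = n + 2 := by
      have : ((n : ℤ) + 3) * ((t : ZMod (n + 3)).val - (n + 2)) = 0 := by
        linear_combination -haff
      rcases mul_eq_zero.mp this with h | h <;> omega
    apply h2
    rw [← neg_eq_iff_eq_neg]
    ext
    apply ZMod.val_injective
    rw [Units.val_neg, Units.val_one, ZMod.val_one]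
    omega

/-- Appending pairs `(1, -1)` extends a tuple of length four to any larger even length,
shifting the value sums of the tuple and of its multiple by `t` by `d` per pair. -/
theorem ZMod.exists_extend_by_pairs {d : ℕ} [NeZero d] [Nontrivial (ZMod d)] (t : (ZMod d)ˣ)
    (b : Fin 4 → ZMod d) (hsum : ∑ i, b i = 0) (hne : ∀ i, b i ≠ 0) (m : ℕ) :
    ∃ a : Fin (4 + 2 * m) → ZMod d, (∑ i, a i = 0) ∧ (∀ i, a i ≠ 0) ∧
      (∑ i, (a i).val = ∑ i, (b i).val + d * m) ∧
      ∑ i, ((t : ZMod d) * a i).val = ∑ i, ((t : ZMod d) * b i).val + d * m := by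
  induction m with
  | zero => exact ⟨b, hsum, hne, by simp, by simp⟩
  | succ m ih =>
    obtain ⟨a, ha, hane, hval, hmul⟩ := ih
    have hone := ZMod.val_add_val_neg (one_ne_zero (α := ZMod d))
    have ht := ZMod.val_add_val_neg t.ne_zero
    rw [show 4 + 2 * (m + 1) = 4 + 2 * m + 1 + 1 by ring]
    refine ⟨Fin.cons 1 (Fin.cons (-1) a : Fin (4 + 2 * m + 1) → ZMod d), ?_, ?_, ?_, ?_⟩
    · rw [Fin.sum_univ_succ, Fin.sum_univ_succ]
      simp [ha]
    · refine Fin.cases (by simp) (Fin.cases (by simp) fun i ↦ ?_)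
      simpa using hane i
    · rw [Fin.sum_univ_succ, Fin.sum_univ_succ]
      simp only [Fin.cons_zero, Fin.cons_succ, hval]
      linarith
    · rw [Fin.sum_univ_succ, Fin.sum_univ_succ]
      simp only [Fin.cons_zero, Fin.cons_succ, hmul, mul_one, mul_neg]
      linarith

/-- If `φ(d) > 2` and `N ≥ 4` is even, then there is `a ∈ (ℤ/dℤ)^N` with zero sum, all
entries nonzero, total value `dN/2`, and a unit `t` of `ℤ/dℤ` for which `t · a` has total
value different from `dN/2`. -/
theorem stmt_3 (d : ℕ) (hd : 1 ≤ d) (hphi : 2 < Nat.totient d)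
    (N : ℕ) (hN : 4 ≤ N) (hNeven : Even N) :
    ∃ a : Fin N → ZMod d,
      (∑ i, a i = 0) ∧ (∀ i, a i ≠ 0) ∧ (∑ i, (a i).val = d * N / 2) ∧
      ∃ t : (ZMod d)ˣ, ∑ i, ((t : ZMod d) * a i).val ≠ d * N / 2 := by
  have : NeZero d := ⟨by omega⟩
  have hd3 : 3 ≤ d := by have := Nat.totient_le d; omega
  have : Fact (1 < d) := ⟨by omega⟩
  obtain ⟨m, rfl⟩ : ∃ m, N = 4 + 2 * m := by
    obtain ⟨k, rfl⟩ := hNeven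
    exact ⟨k - 2, by omega⟩
  have hhalf : d * (4 + 2 * m) / 2 = 2 * d + d * m := by
    rw [show d * (4 + 2 * m) = (2 * d + d * m) * 2 by ring, Nat.mul_div_cancel _ two_pos]
  obtain ⟨t, ht1, ht2⟩ := ZMod.exists_unit_ne_one_ne_neg_one hphi
  obtain ⟨x, hx1, hxd, hx⟩ := ZMod.exists_val_mul_second_difference_ne_zero hd3 ht1 ht2
  have hne : ∀ y : ℕ, 1 ≤ y → y < d → (y : ZMod d) ≠ 0 := fun y hy hyd h0 ↦
    absurd (Nat.le_of_dvd hy ((ZMod.natCast_eq_zero_iff y d).mp h0)) (by omega)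
  have hx0 := hne x hx1 (by omega)
  have hx0' := hne (x + 1) (by omega) (by omega)
  have hx0'' := hne (x + 2) (by omega) hxd
  obtain ⟨a, ha, hane, hval, hmul⟩ := ZMod.exists_extend_by_pairs t
    ![((x : ℕ) : ZMod d), ((x + 2 : ℕ) : ZMod d), -((x + 1 : ℕ) : ZMod d),
      -((x + 1 : ℕ) : ZMod d)]
    (by simp only [Fin.sum_univ_four, Matrix.cons_val]; push_cast; ring)
    (by
      intro i
      fin_cases i
      · exact hx0
      · exact hx0''
      · exact neg_ne_zero.mpr hx0'
      · exact neg_ne_zero.mpr hx0') m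
  refine ⟨a, ha, hane, ?_, t, ?_⟩
  · rw [hval, hhalf]
    simp only [Fin.sum_univ_four, Matrix.cons_val]
    have hneg := ZMod.val_add_val_neg hx0'
    rw [ZMod.val_cast_of_lt (by omega)] at hneg
    rw [ZMod.val_cast_of_lt (by omega), ZMod.val_cast_of_lt hxd]
    omega
  · rw [hmul, hhalf]
    simp only [Fin.sum_univ_four, Matrix.cons_val, mul_neg]
    have hneg := ZMod.val_add_val_neg
      (mt (Units.mul_right_eq_zero t).mp hx0')
    omega
end

section
/- Let d, q, k be positive integers with gcd(q,d) = 1, k ≥ 2, and kq < d < (k+1)q, and let a, b, c ∈ {1,…,k} be integers with a + b + c = k + 1. Then the 4-tuple α = (aq, bq, cq, 2d−(k+1)q), viewed in (ℤ/dℤ)^4, satisfies: the sum of its entries is 0 in ℤ/dℤ, every entry is nonzero, val(α_1)+val(α_2)+val(α_3)+val(α_4) = 2d, and, writing u for the inverse of q in (ℤ/dℤ)ˣ, val(u·α_1)+val(u·α_2)+val(u·α_3)+val(u·α_4) = d (in particular it differs from 2d). -/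
/-- For `gcd(q,d) = 1`, `k ≥ 2`, `kq < d < (k+1)q` and `a,b,c ∈ {1,…,k}` with
`a + b + c = k + 1`, the tuple `α = (aq, bq, cq, 2d - (k+1)q)` in `(ℤ/dℤ)^4` has zero sum,
nonzero entries, total value `2d`, and `u·α` (where `u = q⁻¹`) has total value `d`. -/
theorem stmt_4 (d q k : ℕ) (hd : 0 < d) (hq : 0 < q) (hk : 2 ≤ k)
    (hgcd : Nat.gcd q d = 1) (h1 : k * q < d) (h2 : d < (k + 1) * q)
    (a b c : ℕ) (ha1 : 1 ≤ a) (hak : a ≤ k) (hb1 : 1 ≤ b) (hbk : b ≤ k)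
    (hc1 : 1 ≤ c) (hck : c ≤ k) (habc : a + b + c = k + 1)
    (α : Fin 4 → ZMod d)
    (hα : α = ![((a * q : ℕ) : ZMod d), ((b * q : ℕ) : ZMod d), ((c * q : ℕ) : ZMod d),
      ((2 * d - (k + 1) * q : ℕ) : ZMod d)])
    (u : (ZMod d)ˣ) (hu : (u : ZMod d) * (q : ZMod d) = 1) :
    (∑ i, α i = 0) ∧ (∀ i, α i ≠ 0) ∧
      (∑ i, (α i).val = 2 * d) ∧ (∑ i, ((u : ZMod d) * α i).val = d) := by
  have hq2 : 2 ≤ q := by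
    by_contra! h
    obtain rfl : q = 1 := by omega
    omega
  have hkd : k + 1 < d := by nlinarith
  have hlt : ∀ x, x ≤ k → x * q < d := fun x hx => (Nat.mul_le_mul_right q hx).trans_lt h1
  have hpos : ∀ x, 1 ≤ x → 0 < x * q := fun x hx => Nat.mul_pos hx hq
  have hqd : q < d := by simpa using hlt 1 (by omega)
  have hsum : a * q + b * q + c * q = (k + 1) * q := by rw [← habc]; ring
  have hexp : (k + 1) * q = k * q + q := by ring
  have hal := hlt a hak
  have hbl := hlt b hbk
  have hcl := hlt c hck
  have hap := hpos a ha1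
  have hbp := hpos b hb1
  have hcp := hpos c hc1
  have hvals : ∀ n : ℕ, 0 < n → n < d → (n : ZMod d) ≠ 0 := fun n h0 hn h =>
    absurd (Nat.le_of_dvd h0 ((ZMod.natCast_eq_zero_iff n d).1 h)) (by omega)
  have hmul : ∀ x : ℕ, (u : ZMod d) * ((x * q : ℕ) : ZMod d) = (x : ZMod d) := fun x => by
    push_cast
    linear_combination (x : ZMod d) * hu
  have hlast : (u : ZMod d) * ((2 * d - (k + 1) * q : ℕ) : ZMod d) =
      ((d - (k + 1) : ℕ) : ZMod d) := by
    rw [Nat.cast_sub (by omega), Nat.cast_sub (by omega), mul_sub, hmul]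
    simp
  subst hα
  refine ⟨?_, ?_, ?_, ?_⟩
  · simp only [Fin.sum_univ_four, Matrix.cons_val]
    rw [← Nat.cast_add, ← Nat.cast_add, ← Nat.cast_add,
      show a * q + b * q + c * q + (2 * d - (k + 1) * q) = 2 * d by omega]
    simp
  · intro i
    fin_cases i
    · exact hvals _ hap hal
    · exact hvals _ hbp hbl
    · exact hvals _ hcp hcl
    · exact hvals (2 * d - (k + 1) * q) (by omega) (by omega)
  · simp only [Fin.sum_univ_four, Matrix.cons_val]
    rw [ZMod.val_cast_of_lt hal, ZMod.val_cast_of_lt hbl, ZMod.val_cast_of_lt hcl,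
      ZMod.val_cast_of_lt (by omega)]
    omega
  · simp only [Fin.sum_univ_four, Matrix.cons_val]
    rw [hlast, hmul, hmul, hmul, ZMod.val_cast_of_lt (by omega), ZMod.val_cast_of_lt (by omega),
      ZMod.val_cast_of_lt (by omega), ZMod.val_cast_of_lt (by omega)]
    omega
end

section
/- Let d be an integer with d = 5 or d ≥ 7, let K = ℚ(ζ) be the 2d-th cyclotomic field with ζ ∈ K a primitive 2d-th root of unity, and let c ∈ K be nonzero. Suppose that for every field automorphism σ of K, every positive integer t with σ(ζ) = ζ^t, and all integers a, b ∈ {1,…,d−1}, one has σ( ζ^{a−b} · c^{b−a} ) = ζ^{((ta) mod d) − ((tb) mod d)} · c^{((tb) mod d) − ((ta) mod d)} (integer powers taken in the field K). Then c^d = −1. -/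
/-- For `d = 5` or `d ≥ 7` some `t` prime to `2 * d` is not `±1` modulo `d`: the residues of
consecutive multiples of `t` jump both with and without wrapping around modulo `d`. -/
theorem exists_coprime_wrap (d : ℕ) (hd : d = 5 ∨ 7 ≤ d) :
    ∃ t a b : ℕ, 0 < t ∧ t.Coprime (2 * d) ∧ 1 ≤ a ∧ a + 1 ≤ d - 1 ∧ 1 ≤ b ∧ b + 1 ≤ d - 1 ∧
      (t * (a + 1)) % d + (t * b) % d = (t * (b + 1)) % d + (t * a) % d + d := by
  have mod_eq (x q r : ℕ) (h : x = r + d * q) (hr : r < d) : x % d = r := by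
    rw [h, Nat.add_mul_mod_self_left, Nat.mod_eq_of_lt hr]
  obtain ⟨m, rfl | rfl⟩ := Nat.even_or_odd' d
  · obtain ⟨k, rfl | rfl⟩ := Nat.even_or_odd' m
    · refine ⟨2 * k + 1, 2, 1, by omega, ?_, by omega, by omega, by omega, by omega, ?_⟩
      · have h2 : (2 * k + 1).Coprime 2 := by simp
        have hk : (2 * k + 1).Coprime k := by simp
        exact h2.mul_right (h2.mul_right (h2.mul_right hk))
      · rw [mod_eq _ 1 (2 * k + 3) (by ring) (by omega), mod_eq _ 0 (2 * k + 1) (by ring) (by omega),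
          mod_eq _ 1 2 (by ring) (by omega)]
        ring
    · by_cases h10 : k = 2
      · subst h10
        exact ⟨3, 1, 3, by decide⟩
      · refine ⟨2 * k + 3, 2, 1, by omega, ?_, by omega, by omega, by omega, by omega, ?_⟩
        · have h2 : (2 * k + 3).Coprime 2 := by
            rw [Nat.coprime_two_right]
            exact ⟨k + 1, by ring⟩
          have hk : (2 * k + 3).Coprime (2 * k + 1) := by
            rw [show 2 * k + 3 = 2 + (2 * k + 1) by ring, Nat.coprime_add_self_left]
            simp
          exact h2.mul_right (h2.mul_right hk)
        · rw [mod_eq _ 1 (2 * k + 7) (by ring) (by omega),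
            mod_eq _ 0 (2 * k + 3) (by ring) (by omega),
            mod_eq _ 1 4 (by ring) (by omega)]
          ring
  · refine ⟨2 * m + 3, 1, m, by omega, ?_, by omega, by omega, by omega, by omega, ?_⟩
    · have h2 : (2 * m + 3).Coprime 2 := by
        rw [Nat.coprime_two_right]
        exact ⟨m + 1, by ring⟩
      have hm : (2 * m + 3).Coprime (2 * m + 1) := by
        rw [show 2 * m + 3 = 2 + (2 * m + 1) by ring, Nat.coprime_add_self_left]
        simp
      exact h2.mul_right hm
    · rw [mod_eq _ 2 4 (by ring) (by omega), mod_eq _ m (2 * m) (by ring) (by omega),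
        mod_eq _ (m + 2) 1 (by ring) (by omega), mod_eq _ 1 2 (by ring) (by omega)]
      ring

/-- An automorphism of a cyclotomic extension raising a given primitive root to a given power. -/
theorem exists_algEquiv_apply_eq_pow {n : ℕ} [NeZero n] {K L : Type*} [Field K] [Field L]
    [Algebra K L] [IsCyclotomicExtension {n} K L]
    (hirr : Irreducible (Polynomial.cyclotomic n K)) {ζ : L} (hζ : IsPrimitiveRoot ζ n)
    {t : ℕ} (ht : t.Coprime n) : ∃ σ : L ≃ₐ[K] L, σ ζ = ζ ^ t := by
  have hz := IsCyclotomicExtension.zeta_spec n K L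
  refine ⟨IsCyclotomicExtension.fromZetaAut (hz.pow_of_coprime t ht) hirr, ?_⟩
  obtain ⟨i, -, rfl⟩ := hz.eq_pow_of_pow_eq_one hζ.pow_eq_one
  rw [map_pow, IsCyclotomicExtension.fromZetaAut_spec, pow_right_comm]


/-- Arithmetic core of the non-existence of fake linear cycles for `d = 5` or `d ≥ 7`:
if `c ≠ 0` in the `2d`-th cyclotomic field transforms under every Galois automorphism
`σ(ζ) = ζ^t` by `σ(ζ^{a-b} c^{b-a}) = ζ^{(ta mod d)-(tb mod d)} c^{(tb mod d)-(ta mod d)}`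
for all `a, b ∈ {1,…,d-1}`, then `c^d = -1`. -/
theorem stmt_10 (d : ℕ+) (hd : (d : ℕ) = 5 ∨ 7 ≤ (d : ℕ))
    (ζ : CyclotomicField (2 * d) ℚ) (hζ : IsPrimitiveRoot ζ (2 * (d : ℕ)))
    (c : CyclotomicField (2 * d) ℚ) (hc : c ≠ 0)
    (h : ∀ σ : CyclotomicField (2 * d) ℚ ≃+* CyclotomicField (2 * d) ℚ,
      ∀ t : ℕ, 0 < t → σ ζ = ζ ^ t →
        ∀ a b : ℕ, a ∈ Finset.Icc 1 ((d : ℕ) - 1) → b ∈ Finset.Icc 1 ((d : ℕ) - 1) →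
          σ (ζ ^ ((a : ℤ) - (b : ℤ)) * c ^ ((b : ℤ) - (a : ℤ))) =
            ζ ^ ((((t * a) % (d : ℕ) : ℕ) : ℤ) - (((t * b) % (d : ℕ) : ℕ) : ℤ)) *
              c ^ ((((t * b) % (d : ℕ) : ℕ) : ℤ) - (((t * a) % (d : ℕ) : ℕ) : ℤ))) :
    c ^ (d : ℕ) = -1 := by
  obtain ⟨t, a, b, ht, hcop, ha, ha', hb, hb', hab⟩ := exists_coprime_wrap d hd
  let : Algebra ℚ (CyclotomicField (2 * (d : ℕ)) ℚ) := CyclotomicField.algebra _ _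
  obtain ⟨σ, hσ⟩ := exists_algEquiv_apply_eq_pow (n := 2 * (d : ℕ)) (K := ℚ)
    (Polynomial.cyclotomic.irreducible_rat (by positivity)) hζ hcop
  have hζ0 : ζ ≠ 0 := hζ.ne_zero (by positivity)
  have hd' : ζ ^ (d : ℕ) = -1 := by
    have h2 := hζ.pow (by positivity) (mul_comm 2 (d : ℕ))
    exact h2.eq_neg_one_of_two_right
  have hγ : c / ζ ≠ 0 := div_ne_zero hc hζ0
  have key (m n : ℤ) : ζ ^ (m - n) * c ^ (n - m) = (c / ζ) ^ (n - m) := by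
    rw [div_zpow, div_eq_mul_inv, ← zpow_neg, neg_sub, mul_comm (ζ ^ _)]
  have step (x : ℕ) (hx : 1 ≤ x) (hx' : x + 1 ≤ (d : ℕ) - 1) :
      σ (c / ζ) = (c / ζ) ^ ((((t * (x + 1)) % (d : ℕ) : ℕ) : ℤ) - ((t * x) % (d : ℕ) : ℕ)) := by
    have := h σ.toRingEquiv t ht hσ x (x + 1) (Finset.mem_Icc.2 ⟨hx, by omega⟩)
      (Finset.mem_Icc.2 ⟨by omega, hx'⟩)
    rw [key, key] at this
    simpa using this
  have hpow := (step a ha ha').symm.trans (step b hb hb')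
  have h1 : (c / ζ) ^ (d : ℕ) = 1 := by
    rw [← zpow_natCast, show ((d : ℕ) : ℤ) =
      ((((t * (a + 1)) % (d : ℕ) : ℕ) : ℤ) - ((t * a) % (d : ℕ) : ℕ)) -
      ((((t * (b + 1)) % (d : ℕ) : ℕ) : ℤ) - ((t * b) % (d : ℕ) : ℕ)) by omega,
      zpow_sub₀ hγ, hpow, div_self (zpow_ne_zero _ hγ)]
  rw [← div_mul_cancel₀ c hζ0, mul_pow, h1, hd', one_mul]
end

section
/- Let K = ℚ(ζ) be the eighth cyclotomic field with ζ ∈ K a primitive 8-th root of unity, and let σ_3, σ_5, σ_7 be the field automorphisms of K determined by σ_j(ζ) = ζ^j for j = 3, 5, 7. Let u ∈ K and ε ∈ {1,−1} satisfy σ_5(u) = ε·u and σ_7(u)·u = 1. Then there exists a nonzero c ∈ K such that σ_3(c) = u²·c, σ_5(c) = ε·c, and σ_7(c) = ε·u²·c. -/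
/-- Ring homomorphisms out of a cyclotomic extension of `ℚ` agree once they agree on a primitive
root of unity. -/
theorem IsCyclotomicExtension.ringHom_ext_of_isPrimitiveRoot {n : ℕ} [NeZero n]
    {K L : Type*} [Field K] [Algebra ℚ K] [IsCyclotomicExtension {n} ℚ K] [Field L] [CharZero L]
    {ζ : K} (hζ : IsPrimitiveRoot ζ n) {f g : K →+* L} (h : f ζ = g ζ) : f = g := by
  have hfg : f.toRatAlgHom = g.toRatAlgHom := by
    apply (hζ.powerBasis ℚ).algHom_ext
    simpa using h
  ext x
  exact congrArg (fun φ => φ x) hfg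

/-- Existence of the coefficient `c_λ` for fake linear cycles on the Fermat quartic, via
Hilbert's Theorem 90 in the eighth cyclotomic field. -/
theorem stmt_12 (ζ : CyclotomicField 8 ℚ) (hζ : IsPrimitiveRoot ζ 8)
    (σ3 σ5 σ7 : CyclotomicField 8 ℚ ≃+* CyclotomicField 8 ℚ)
    (hσ3 : σ3 ζ = ζ ^ 3) (hσ5 : σ5 ζ = ζ ^ 5) (hσ7 : σ7 ζ = ζ ^ 7)
    (u ε : CyclotomicField 8 ℚ) (hε : ε = 1 ∨ ε = -1)
    (hu5 : σ5 u = ε * u) (hu7 : σ7 u * u = 1) :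
    ∃ c : CyclotomicField 8 ℚ, c ≠ 0 ∧
      σ3 c = u ^ 2 * c ∧ σ5 c = ε * c ∧ σ7 c = ε * u ^ 2 * c := by
  have hζ4 : ζ ^ 4 = -1 := by
    have h2 : IsPrimitiveRoot (ζ ^ 4) 2 := hζ.pow (by norm_num) (by norm_num)
    exact h2.eq_neg_one_of_two_right
  have hζ0 : ζ ≠ 0 := hζ.ne_zero (by norm_num)
  have hu0 : u ≠ 0 := right_ne_zero_of_mul_eq_one hu7
  have hu7' : σ7 u = u⁻¹ := eq_inv_of_mul_eq_one_left hu7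
  have : IsCyclotomicExtension {8} ℚ (CyclotomicField 8 ℚ) :=
    CyclotomicField.isCyclotomicExtension 8 ℚ
  have hcomp : (σ3 : CyclotomicField 8 ℚ →+* CyclotomicField 8 ℚ) =
      (σ5 : CyclotomicField 8 ℚ →+* CyclotomicField 8 ℚ).comp σ7 := by
    apply IsCyclotomicExtension.ringHom_ext_of_isPrimitiveRoot hζ
    simp only [RingHom.comp_apply, RingHom.coe_coe, hσ3, hσ5, hσ7, map_pow]
    linear_combination (-ζ ^ 3) * (ζ ^ 4 - 1) * (ζ ^ 8 + 1) * (ζ ^ 16 + 1) * hζ4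
  have hu3 : σ3 u = (ε * u)⁻¹ := by
    have h := RingHom.congr_fun hcomp u
    simpa only [RingHom.comp_apply, RingHom.coe_coe, hu7', map_inv₀, hu5] using h
  rcases hε with rfl | rfl
  · by_cases h : u ^ 2 = -1
    · refine ⟨ζ ^ 2, pow_ne_zero _ hζ0, ?_, ?_, ?_⟩ <;>
        simp only [map_pow, hσ3, hσ5, hσ7, h]
      · linear_combination ζ ^ 2 * hζ4
      · linear_combination ζ ^ 2 * (ζ ^ 4 - 1) * hζ4
      · linear_combination ζ ^ 2 * (ζ ^ 8 - ζ ^ 4 + 1) * hζ4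
    · refine ⟨1 + (u ^ 2)⁻¹, fun h0 => h ?_, ?_, ?_, ?_⟩
      · field_simp at h0
        linear_combination h0
      all_goals
        simp only [map_add, map_one, map_inv₀, map_pow, hu3, hu5, hu7', one_mul]
        try field_simp
        try ring
  · by_cases h : u ^ 2 = -ζ ^ 2
    · refine ⟨ζ ^ 3, pow_ne_zero _ hζ0, ?_, ?_, ?_⟩ <;>
        simp only [map_pow, hσ3, hσ5, hσ7, h]
      · linear_combination ζ ^ 5 * hζ4
      · linear_combination ζ ^ 3 * (ζ ^ 8 - ζ ^ 4 + 1) * hζ4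
      · linear_combination ζ ^ 5 * (ζ ^ 12 - ζ ^ 8 + ζ ^ 4 - 1) * hζ4
    · have h8 : ζ ^ 8 = 1 := hζ.pow_eq_one
      have h5 : ζ ^ 5 = -ζ := by linear_combination ζ * hζ4
      have h7 : ζ ^ 7 = -ζ ^ 3 := by linear_combination ζ ^ 3 * hζ4
      refine ⟨ζ + (u ^ 2)⁻¹ * ζ ^ 3, fun h0 => h ?_, ?_, ?_, ?_⟩
      · field_simp at h0
        apply mul_left_cancel₀ hζ0
        linear_combination h0
      all_goals
        simp only [map_add, map_mul, map_inv₀, map_pow, hu3, hu5, hu7', hσ3, hσ5, hσ7, h5, h7]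
        field_simp
        try ring_nf
        try simp only [h8, one_mul]
end

section
/- Let K = ℚ(ζ) be the twelfth cyclotomic field with ζ ∈ K a primitive 12-th root of unity, and let σ_5, σ_7, σ_11 be the field automorphisms of K determined by σ_j(ζ) = ζ^j for j = 5, 7, 11. Let u ∈ K and ε ∈ {1,−1} satisfy σ_7(u) = ε·u and σ_11(u)·u = 1. Then there exists a nonzero c ∈ K such that σ_5(c) = u⁴·c, σ_7(c) = ε·c, and σ_11(c) = ε·u⁴·c. -/
/-- Ring homomorphisms out of a cyclotomic extension of `ℚ` are determined by their value on a
primitive root of unity. -/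
theorem IsPrimitiveRoot.ringHom_ext_of_isCyclotomicExtension {K L : Type*} [Field K] [Algebra ℚ K]
    [Field L] [Algebra ℚ L] {n : ℕ} [NeZero n] [IsCyclotomicExtension {n} ℚ K] {ζ : K}
    (hζ : IsPrimitiveRoot ζ n) {f g : K →+* L} (h : f ζ = g ζ) : f = g := by
  have key : f.toRatAlgHom = g.toRatAlgHom :=
    (hζ.powerBasis ℚ).algHom_ext (by simpa using h)
  ext x
  exact DFunLike.congr_fun key x

/-- Existence of the coefficient `c_λ` for fake linear cycles on the Fermat sextic, via
Hilbert's Theorem 90 in the twelfth cyclotomic field. -/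
theorem stmt_13 (ζ : CyclotomicField 12 ℚ) (hζ : IsPrimitiveRoot ζ 12)
    (σ5 σ7 σ11 : CyclotomicField 12 ℚ ≃+* CyclotomicField 12 ℚ)
    (hσ5 : σ5 ζ = ζ ^ 5) (hσ7 : σ7 ζ = ζ ^ 7) (hσ11 : σ11 ζ = ζ ^ 11)
    (u ε : CyclotomicField 12 ℚ) (hε : ε = 1 ∨ ε = -1)
    (hu7 : σ7 u = ε * u) (hu11 : σ11 u * u = 1) :
    ∃ c : CyclotomicField 12 ℚ, c ≠ 0 ∧
      σ5 c = u ^ 4 * c ∧ σ7 c = ε * c ∧ σ11 c = ε * u ^ 4 * c := by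
  have : IsCyclotomicExtension {12} ℚ (CyclotomicField 12 ℚ) := by
    convert CyclotomicField.isCyclotomicExtension 12 ℚ
    · rfl
    · exact Subsingleton.elim (α := Algebra ℚ (CyclotomicField 12 ℚ)) _ _
  have h12 : ζ ^ 12 = 1 := hζ.pow_eq_one
  have h6 : ζ ^ 6 = -1 :=
    (hζ.pow (by norm_num) (show 12 = 6 * 2 by norm_num)).eq_neg_one_of_two_right
  have hu0 : u ≠ 0 := right_ne_zero_of_mul_eq_one hu11
  have hε4 : ε ^ 4 = 1 := by rcases hε with rfl | rfl <;> norm_num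
  have hεσ (σ : CyclotomicField 12 ℚ ≃+* CyclotomicField 12 ℚ) : σ ε = ε := by
    rcases hε with rfl | rfl <;> simp
  have h5 (z) : σ5 z = σ11 (σ7 z) := by
    have : (σ5 : CyclotomicField 12 ℚ →+* CyclotomicField 12 ℚ) =
        (σ11 : CyclotomicField 12 ℚ →+* CyclotomicField 12 ℚ).comp σ7 := by
      apply hζ.ringHom_ext_of_isCyclotomicExtension
      simp only [RingHom.comp_apply, RingHom.coe_coe, hσ5, hσ7, map_pow, hσ11]
      linear_combination (-ζ ^ 5) * (congrArg (· ^ 6) h12)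
    exact DFunLike.congr_fun this z
  have h11 (z) : σ11 z = σ5 (σ7 z) := by
    have : (σ11 : CyclotomicField 12 ℚ →+* CyclotomicField 12 ℚ) =
        (σ5 : CyclotomicField 12 ℚ →+* CyclotomicField 12 ℚ).comp σ7 := by
      apply hζ.ringHom_ext_of_isCyclotomicExtension
      simp only [RingHom.comp_apply, RingHom.coe_coe, hσ5, hσ7, map_pow, hσ11]
      linear_combination (-ζ ^ 11) * (congrArg (· ^ 2) h12)
    exact DFunLike.congr_fun this z
  have hu5 : σ5 u = ε * u⁻¹ := by
    rw [h5, hu7, map_mul, hεσ, eq_inv_of_mul_eq_one_left hu11]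
  have hw5 : σ5 (u⁻¹ ^ 4) = u ^ 4 := by
    rw [map_pow, map_inv₀, hu5, mul_inv, inv_inv, mul_pow, inv_pow, hε4, inv_one, one_mul]
  have hw7 : σ7 (u⁻¹ ^ 4) = u⁻¹ ^ 4 := by
    rw [map_pow, map_inv₀, hu7, mul_inv, mul_pow, inv_pow ε, hε4, inv_one, one_mul]
  have hw : u ^ 4 * u⁻¹ ^ 4 = 1 := by rw [← mul_pow, mul_inv_cancel₀ hu0, one_pow]
  have hsol (a : ℕ) (ha : (ζ ^ 6) ^ a = ε) (hne : ζ ^ a + u⁻¹ ^ 4 * (ζ ^ a) ^ 5 ≠ 0) :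
      ∃ c : CyclotomicField 12 ℚ, c ≠ 0 ∧
        σ5 c = u ^ 4 * c ∧ σ7 c = ε * c ∧ σ11 c = ε * u ^ 4 * c := by
    have hx5 : σ5 (ζ ^ a) = (ζ ^ a) ^ 5 := by rw [map_pow, hσ5, pow_right_comm]
    have hx7 : σ7 (ζ ^ a) = ε * ζ ^ a := by
      rw [map_pow, hσ7, ← ha, ← mul_pow, ← pow_succ]
    have hx12 : (ζ ^ a) ^ 12 = 1 := by rw [pow_right_comm, h12, one_pow]
    have hc5 : σ5 (ζ ^ a + u⁻¹ ^ 4 * (ζ ^ a) ^ 5) =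
        u ^ 4 * (ζ ^ a + u⁻¹ ^ 4 * (ζ ^ a) ^ 5) := by
      rw [map_add, map_mul, hw5, map_pow σ5 (ζ ^ a), hx5]
      generalize ζ ^ a = x at *
      linear_combination u ^ 4 * x * (x ^ 12 + 1) * hx12 - x ^ 5 * hw
    have hc7 : σ7 (ζ ^ a + u⁻¹ ^ 4 * (ζ ^ a) ^ 5) =
        ε * (ζ ^ a + u⁻¹ ^ 4 * (ζ ^ a) ^ 5) := by
      rw [map_add, map_mul, hw7, map_pow σ7 (ζ ^ a), hx7]
      linear_combination u⁻¹ ^ 4 * ε * (ζ ^ a) ^ 5 * hε4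
    refine ⟨_, hne, hc5, hc7, ?_⟩
    rw [h11, hc7, map_mul, hεσ, hc5, mul_assoc]
  have hζ0 : ζ ≠ 0 := hζ.ne_zero (by norm_num)
  have hdistinct : ζ ^ 8 ≠ 1 := hζ.pow_ne_one_of_pos_of_lt (by norm_num) (by norm_num)
  obtain ⟨a, ha⟩ : ∃ a : ℕ, (ζ ^ 6) ^ a = ε := by
    rcases hε with rfl | rfl
    · exact ⟨0, pow_zero _⟩
    · exact ⟨1, by rw [h6, pow_one]⟩
  by_cases hne : ζ ^ a + u⁻¹ ^ 4 * (ζ ^ a) ^ 5 = 0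
  · refine hsol (a + 2) (by rw [pow_add, ha, h6]; norm_num) fun h => hdistinct ?_
    rw [pow_add] at h
    have hx0 : ζ ^ a ≠ 0 := pow_ne_zero _ hζ0
    generalize ζ ^ a = x at *
    have : x * ζ ^ 2 * (ζ ^ 8 - 1) = 0 := by
      linear_combination ζ ^ 10 * hne - h
    have h0 : x * ζ ^ 2 ≠ 0 := mul_ne_zero hx0 (pow_ne_zero _ hζ0)
    exact sub_eq_zero.mp ((mul_eq_zero.mp this).resolve_left h0)
  · exact hsol a ha hne
end
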